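/- arXiv:2505.05199 — 2 statements merged into one kernel-verified Lean document; each statement's English description precedes it below -/
import Mathlib

section
/- For every N ≥ 1 and d : Fin N → ℝ, with X_q = Σ_{j=1}^N d_j^{2q}, the torus moments satisfy I_1(d) = X_1, I_2(d) = 2X_1² − X_2, and I_3(d) = 6X_1³ − 9X_1X_2 + 4X_3. -/
open MeasureTheory Real Filter Finset Nat

/-- The `m`-th torus moment of the weight vector `d`: the average of
`|Σ_j d_j e^{iθ_j}|^{2m}` over `N` independent angles uniform on `[0, 2π]`. -/
noncomputable def torusMoment (N : ℕ) (d : Fin N → ℝ) (m : ℕ) : ℝ :=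
  ((2 * π) ^ N)⁻¹ *
    ∫ θ : Fin N → ℝ in Set.univ.pi (fun _ => Set.Icc 0 (2 * π)),
      ‖∑ j, (d j : ℂ) * Complex.exp (Complex.I * (θ j : ℂ))‖ ^ (2 * m)

/-- `X_q = Σ_j d_j^{2q}`. -/
noncomputable def Xpow (N : ℕ) (d : Fin N → ℝ) (q : ℕ) : ℝ := ∑ j, d j ^ (2 * q)

lemma integral_exp_I_mul_int_mul (n : ℤ) :
    ∫ x in (0 : ℝ)..2 * π, Complex.exp (Complex.I * n * x) = if n = 0 then 2 * (π : ℂ) else 0 := by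
  split_ifs with h
  · simp [h]
  · have hc : Complex.I * (n : ℂ) ≠ 0 := mul_ne_zero Complex.I_ne_zero (by exact_mod_cast h)
    rw [integral_exp_mul_complex hc]
    have : Complex.I * (n : ℂ) * ((2 * π : ℝ) : ℂ) = n * (2 * π * Complex.I) := by
      push_cast; ring
    rw [this, Complex.exp_int_mul_two_pi_mul_I]
    simp

/-- Parseval's identity for the binomial expansion of `(a e^{ix} + b)^m`. -/
lemma integral_norm_mul_exp_add_pow (a b : ℂ) (m : ℕ) :
    ∫ x in Set.Icc 0 (2 * π), ‖a * Complex.exp (Complex.I * (x : ℂ)) + b‖ ^ (2 * m) =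
      2 * π * ∑ k ∈ range (m + 1), (m.choose k : ℝ) ^ 2 * ‖a‖ ^ (2 * k) * ‖b‖ ^ (2 * (m - k)) := by
  rw [integral_Icc_eq_integral_Ioc, ← intervalIntegral.integral_of_le (by positivity)]
  apply Complex.ofReal_injective
  rw [← intervalIntegral.integral_ofReal]
  let u (k : ℕ) : ℂ := a ^ k * b ^ (m - k) * m.choose k
  have expand (x : ℝ) :
      ((‖a * Complex.exp (Complex.I * (x : ℂ)) + b‖ ^ (2 * m) : ℝ) : ℂ) =
        ∑ k ∈ range (m + 1), ∑ l ∈ range (m + 1), u k * (starRingEnd ℂ) (u l) *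
          Complex.exp (Complex.I * ((k - l : ℤ) : ℂ) * x) := by
    have hz : (a * Complex.exp (Complex.I * (x : ℂ)) + b) ^ m =
        ∑ k ∈ range (m + 1), u k * Complex.exp (k * (Complex.I * x)) := by
      rw [add_pow]
      refine Finset.sum_congr rfl fun k _ => ?_
      rw [Complex.exp_nat_mul]
      ring
    rw [mul_comm 2 m, pow_mul, ← norm_pow, Complex.ofReal_pow, ← Complex.mul_conj', hz, map_sum,
      Finset.sum_mul_sum]
    refine Finset.sum_congr rfl fun k _ => Finset.sum_congr rfl fun l _ => ?_
    have he : Complex.exp (Complex.I * ((k - l : ℤ) : ℂ) * x) =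
        Complex.exp (k * (Complex.I * x)) * (starRingEnd ℂ) (Complex.exp (l * (Complex.I * x))) := by
      rw [← Complex.exp_conj, ← Complex.exp_add]
      congr 1
      simp
      ring
    rw [he, map_mul]
    ring
  simp_rw [expand]
  rw [intervalIntegral.integral_finsetSum
    fun k _ => Continuous.intervalIntegrable (by fun_prop) _ _]
  rw [Complex.ofReal_mul, Complex.ofReal_sum, Finset.mul_sum]
  refine Finset.sum_congr rfl fun k hk => ?_
  rw [intervalIntegral.integral_finsetSum
    fun l _ => Continuous.intervalIntegrable (by fun_prop) _ _]
  simp_rw [intervalIntegral.integral_const_mul, integral_exp_I_mul_int_mul, sub_eq_zero,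
    Nat.cast_inj, mul_ite, mul_zero]
  rw [Finset.sum_ite_eq, if_pos hk, Complex.mul_conj']
  simp only [u, norm_mul, norm_pow, Complex.norm_natCast]
  push_cast
  ring

/-- Averaging over the first angle expresses the moments of `d` through those of its tail. -/
lemma torusMoment_succ (N : ℕ) (d : Fin (N + 1) → ℝ) (m : ℕ) :
    torusMoment (N + 1) d m = ∑ k ∈ range (m + 1),
      (m.choose k : ℝ) ^ 2 * d 0 ^ (2 * k) * torusMoment N (fun j => d j.succ) (m - k) := by
  let μ : Measure ℝ := volume.restrict (Set.Icc 0 (2 * π))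
  have hvol (n : ℕ) : (volume : Measure (Fin n → ℝ)).restrict
      (Set.univ.pi fun _ => Set.Icc 0 (2 * π)) = Measure.pi fun _ => μ := by
    rw [volume_pi, Measure.restrict_pi_pi]
  let S (θ : Fin N → ℝ) : ℂ := ∑ j, (d j.succ : ℂ) * Complex.exp (Complex.I * (θ j : ℂ))
  have hS : Continuous S := by fun_prop
  have hSb (θ : Fin N → ℝ) : ‖S θ‖ ≤ ∑ j : Fin N, |d j.succ| :=
    norm_sum_le_of_le _ fun j _ => by simp [Complex.norm_exp]
  have hint (q : ℕ) : Integrable (fun θ => ‖S θ‖ ^ q) (Measure.pi fun _ : Fin N => μ) := by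
    refine Integrable.of_bound (by fun_prop) ((∑ j : Fin N, |d j.succ|) ^ q) (ae_of_all _ fun θ => ?_)
    rw [norm_pow, norm_norm]
    exact pow_le_pow_left₀ (norm_nonneg _) (hSb θ) q
  have hint' : Integrable (fun p : ℝ × (Fin N → ℝ) =>
      ‖(d 0 : ℂ) * Complex.exp (Complex.I * (p.1 : ℂ)) + S p.2‖ ^ (2 * m))
      (μ.prod (Measure.pi fun _ => μ)) := by
    refine Integrable.of_bound (by fun_prop) ((|d 0| + ∑ j : Fin N, |d j.succ|) ^ (2 * m))
      (ae_of_all _ fun p => ?_)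
    rw [norm_pow, norm_norm]
    refine pow_le_pow_left₀ (norm_nonneg _) ((norm_add_le _ _).trans ?_) _
    exact add_le_add (by simp [Complex.norm_exp]) (hSb _)
  have hsplit : ∫ θ, ‖∑ j, (d j : ℂ) * Complex.exp (Complex.I * (θ j : ℂ))‖ ^ (2 * m)
        ∂(Measure.pi fun _ : Fin (N + 1) => μ) =
      ∫ p : ℝ × (Fin N → ℝ), ‖(d 0 : ℂ) * Complex.exp (Complex.I * (p.1 : ℂ)) + S p.2‖ ^ (2 * m)
        ∂(μ.prod (Measure.pi fun _ => μ)) := by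
    rw [← (measurePreserving_piFinSuccAbove (fun _ : Fin (N + 1) => μ) 0).integral_comp'
      (f := MeasurableEquiv.piFinSuccAbove (fun _ => ℝ) 0)]
    refine integral_congr_ae (ae_of_all _ fun θ => ?_)
    simp [S, Fin.sum_univ_succ, MeasurableEquiv.piFinSuccAbove, Fin.insertNthEquiv, Fin.tail]
  simp only [torusMoment, hvol]
  rw [hsplit, integral_prod_symm _ hint']
  simp only [μ, integral_norm_mul_exp_add_pow]
  rw [integral_const_mul, integral_finsetSum _ fun k _ => (hint _).const_mul _, ← mul_assoc,
    Finset.mul_sum]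
  refine Finset.sum_congr rfl fun k _ => ?_
  rw [integral_const_mul, Complex.norm_real, Real.norm_eq_abs, pow_mul |d 0|, sq_abs, ← pow_mul]
  have := Real.pi_pos
  simp only [S, μ]
  field_simp
  ring

lemma torusMoment_fin_zero (d : Fin 0 → ℝ) (m : ℕ) : torusMoment 0 d m = 0 ^ (2 * m) := by
  rw [torusMoment, volume_pi, Measure.restrict_pi_pi]
  simp [measureReal_def]

lemma torusMoment_zero (N : ℕ) (d : Fin N → ℝ) : torusMoment N d 0 = 1 := by
  induction N with
  | zero => simp [torusMoment_fin_zero]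
  | succ N ih => simp [torusMoment_succ, ih]

lemma Xpow_succ (N : ℕ) (d : Fin (N + 1) → ℝ) (q : ℕ) :
    Xpow (N + 1) d q = d 0 ^ (2 * q) + Xpow N (fun j => d j.succ) q :=
  Fin.sum_univ_succ _

/-- The first three torus moments: `I₁ = X₁`, `I₂ = 2X₁² − X₂`,
`I₃ = 6X₁³ − 9X₁X₂ + 4X₃`. -/
theorem torusMoment_one_two_three (N : ℕ) (hN : 1 ≤ N) (d : Fin N → ℝ) :
    torusMoment N d 1 = Xpow N d 1 ∧
    torusMoment N d 2 = 2 * (Xpow N d 1) ^ 2 - Xpow N d 2 ∧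
    torusMoment N d 3 =
      6 * (Xpow N d 1) ^ 3 - 9 * Xpow N d 1 * Xpow N d 2 + 4 * Xpow N d 3 := by
  clear hN
  induction N with
  | zero => simp [torusMoment_fin_zero, Xpow]
  | succ N ih =>
    obtain ⟨h1, h2, h3⟩ := ih fun j => d j.succ
    have choose_three_two : Nat.choose 3 2 = 3 := rfl
    refine ⟨?_, ?_, ?_⟩ <;>
    · simp only [torusMoment_succ, Xpow_succ, Finset.sum_range_succ, Finset.sum_range_zero,
        Nat.reduceSub, Nat.sub_zero, Nat.sub_self, h1, h2, h3, torusMoment_zero,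
        Nat.choose_zero_right, Nat.choose_self, Nat.choose_one_right, choose_three_two]
      push_cast
      ring
end

section
/- Let L ≥ 1, let ε : Fin L → ℝ be a family that is linearly independent over ℚ (viewing ℝ as a ℚ-vector space), let g : Fin L → ℕ with g_j ≥ 1 for all j, and let M ≥ 1. Then lim_{T→∞} (1/T) ∫₀^T Π_{j=1}^L (2 cos(t ε_j/2))^{2 g_j M} dt = Π_{j=1}^L binom(2 g_j M, g_j M), where binom(2n, n) denotes the central binomial coefficient. -/
open MeasureTheory Real Filter Finset

lemma two_mul_cos_half_pow (x : ℝ) (n : ℕ) :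
    (((2 * Real.cos (x / 2)) ^ (2 * n) : ℝ) : ℂ) =
      ∑ m ∈ range (2 * n + 1), ((2 * n).choose m : ℂ) *
        Complex.exp (((((m : ℝ) - n) * x : ℝ) : ℂ) * Complex.I) := by
  push_cast
  rw [Complex.two_cos, add_pow]
  refine Finset.sum_congr rfl fun m hm => ?_
  have hle : m ≤ 2 * n := Nat.lt_succ_iff.mp (mem_range.mp hm)
  rw [← Complex.exp_nat_mul, ← Complex.exp_nat_mul, ← Complex.exp_add, mul_comm]
  congr 2
  push_cast [Nat.cast_sub hle]
  ring

lemma tendsto_average_exp (w : ℝ) :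
    Tendsto (fun T : ℝ => (T : ℂ)⁻¹ * ∫ t in (0:ℝ)..T, Complex.exp (w * Complex.I * t))
      atTop (nhds (if w = 0 then 1 else 0)) := by
  split_ifs with hw
  · refine tendsto_const_nhds.congr' ?_
    filter_upwards [eventually_gt_atTop 0] with T hT
    have : (T : ℂ) ≠ 0 := by exact_mod_cast hT.ne'
    simp [hw, this]
  · have hc : (w : ℂ) * Complex.I ≠ 0 := by simp [hw]
    simp_rw [integral_exp_mul_complex hc]
    have hinv : Tendsto (fun T : ℝ => (T : ℂ)⁻¹) atTop (nhds 0) := by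
      have := (Complex.continuous_ofReal.tendsto 0).comp tendsto_inv_atTop_zero
      simpa [Function.comp_def] using this
    refine hinv.zero_mul_isBoundedUnder_le ?_
    refine isBoundedUnder_of ⟨2 / ‖(w : ℂ) * Complex.I‖, fun T => ?_⟩
    simp only [Function.comp_apply, norm_div]
    gcongr
    refine (norm_sub_le _ _).trans ?_
    have h1 : ‖Complex.exp (w * Complex.I * T)‖ = 1 := by
      rw [show (w : ℂ) * Complex.I * T = ((w * T : ℝ) : ℂ) * Complex.I by push_cast; ring]
      exact Complex.norm_exp_ofReal_mul_I _
    rw [h1]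
    norm_num

lemma sum_sub_mul_eq_zero_iff {ι : Type*} [Fintype ι] {ε : ι → ℝ}
    (hε : LinearIndependent ℚ ε) (k n : ι → ℕ) :
    ∑ j, ((k j : ℝ) - n j) * ε j = 0 ↔ k = n := by
  refine ⟨fun h => ?_, fun h => by simp [h]⟩
  have hlin := Fintype.linearIndependent_iff.mp hε (fun j => (k j : ℚ) - n j)
    (by simpa [Rat.smul_def] using h)
  funext j
  exact_mod_cast sub_eq_zero.mp (hlin j)

lemma prod_two_mul_cos_half_pow {ι : Type*} [Fintype ι] [DecidableEq ι] (ε : ι → ℝ)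
    (n : ι → ℕ) (t : ℝ) :
    ((∏ j, (2 * Real.cos (t * ε j / 2)) ^ (2 * n j) : ℝ) : ℂ) =
      ∑ k ∈ Fintype.piFinset fun j => range (2 * n j + 1),
        (∏ j, ((2 * n j).choose (k j) : ℂ)) *
          Complex.exp (((∑ j, ((k j : ℝ) - n j) * ε j : ℝ) : ℂ) * Complex.I * t) := by
  rw [Complex.ofReal_prod]
  simp_rw [two_mul_cos_half_pow]
  rw [Finset.prod_univ_sum]
  refine Finset.sum_congr rfl fun k _ => ?_
  rw [Finset.prod_mul_distrib, ← Complex.exp_sum]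
  congr 2
  push_cast
  rw [Finset.sum_mul, Finset.sum_mul]
  exact Finset.sum_congr rfl fun j _ => by ring

lemma tendsto_average_prod_cos {ι : Type*} [Fintype ι] {ε : ι → ℝ}
    (hε : LinearIndependent ℚ ε) (n : ι → ℕ) :
    Tendsto (fun T : ℝ => T⁻¹ * ∫ t in (0:ℝ)..T, ∏ j, (2 * Real.cos (t * ε j / 2)) ^ (2 * n j))
      atTop (nhds (∏ j, ((2 * n j).choose (n j) : ℝ))) := by
  classical
  rw [Complex.isometry_ofReal.isEmbedding.tendsto_nhds_iff]
  have hlim := tendsto_finsetSum (Fintype.piFinset fun j => range (2 * n j + 1)) fun k _ =>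
    (tendsto_average_exp (∑ j, ((k j : ℝ) - n j) * ε j)).const_mul
      (∏ j, ((2 * n j).choose (k j) : ℂ))
  have hmem : n ∈ Fintype.piFinset fun j => range (2 * n j + 1) := by
    simp only [Fintype.mem_piFinset, mem_range]
    intro j
    omega
  simp only [sum_sub_mul_eq_zero_iff hε, mul_ite, mul_one, mul_zero, Finset.sum_ite_eq',
    hmem, if_true] at hlim
  push_cast
  refine hlim.congr fun T => ?_
  rw [Function.comp_apply, Complex.ofReal_mul, Complex.ofReal_inv, ← intervalIntegral.integral_ofReal]
  simp_rw [prod_two_mul_cos_half_pow]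
  rw [intervalIntegral.integral_finsetSum
    fun k _ => Continuous.intervalIntegrable (by fun_prop) _ _, Finset.mul_sum]
  refine Finset.sum_congr rfl fun k _ => ?_
  rw [intervalIntegral.integral_const_mul]
  ring

/-- Infinite time average of the `2M`-th power of the quasi-free spectral form factor:
for rationally independent one-particle energies `ε_j` with degeneracies `g_j`,
`lim_{T→∞} (1/T) ∫₀^T Π_j (2 cos(t ε_j/2))^{2 g_j M} dt = Π_j binom(2 g_j M, g_j M)`. -/
theorem quasifree_SFF_time_average
    (L : ℕ) (hL : 1 ≤ L) (ε : Fin L → ℝ) (hε : LinearIndependent ℚ ε)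
    (g : Fin L → ℕ) (hg : ∀ j, 1 ≤ g j) (M : ℕ) (hM : 1 ≤ M) :
    Tendsto (fun T : ℝ => T⁻¹ *
        ∫ t in (0:ℝ)..T, ∏ j, (2 * Real.cos (t * ε j / 2)) ^ (2 * g j * M))
      atTop (nhds (∏ j, ((2 * g j * M).choose (g j * M) : ℝ))) := by
  simpa only [mul_assoc] using tendsto_average_prod_cos hε fun j => g j * M
end
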